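/- Let d ∈ ℕ and α ∈ (0, min(2,d)). For all β ∈ (0, d-α), all t > 0 and all x ∈ ℝ^d \ {0}, ∫_{ℝ^d} p(t,x,y) h_β(y) dy + ∫_0^t ∫_{ℝ^d} p(s,x,y) h̄_β(y) dy ds = h_β(x), where h̄_β(y) = ((d-α-β)/α) h_{β+α}(y). -/

import Mathlib

open MeasureTheory Real Set Filter RealInnerProductSpace

noncomputable section

/-- Euclidean space `ℝ^d`. -/
abbrev Ed (d : ℕ) := EuclideanSpace ℝ (Fin d)

/-- Modified Bessel function of the second kind `K_ν(r)`. -/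
def besselK (ν r : ℝ) : ℝ :=
  (1 / 2) * (r / 2) ^ ν * ∫ u in Ioi (0 : ℝ), u ^ (-ν - 1) * Real.exp (-u - r ^ 2 / (4 * u))

/-- Relativistic `α`-stable heat kernel with mass parameter `m`:
`p^m(t,x,y) = (2π)^{-d} ∫ exp(-i⟨y-x,z⟩) exp(-t(|z|²+m^{2/α})^{α/2}) dz`
(the integral is real, and equals the cosine integral below). -/
def relKernel (d : ℕ) (α m t : ℝ) (x y : Ed d) : ℝ :=
  (2 * π) ^ (-(d : ℝ)) *
    ∫ z : Ed d, Real.cos ⟪y - x, z⟫ * Real.exp (-t * (‖z‖ ^ 2 + m ^ (2 / α)) ^ (α / 2))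

/-- Fractional (`α`-stable) heat kernel `p⁰(t,x,y)`. -/
def fracKernel (d : ℕ) (α t : ℝ) (x y : Ed d) : ℝ :=
  (2 * π) ^ (-(d : ℝ)) * ∫ z : Ed d, Real.cos ⟪y - x, z⟫ * Real.exp (-t * ‖z‖ ^ α)

/-- The summands of the perturbation series. -/
def pertN (d : ℕ) (k : ℝ → Ed d → Ed d → ℝ) (q : Ed d → ℝ) : ℕ → ℝ → Ed d → Ed d → ℝ
  | 0 => k
  | n + 1 => fun t x y =>
      ∫ s in Ioo (0 : ℝ) t, ∫ z : Ed d, pertN d k q n s x z * q z * k (t - s) z y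

/-- Schrödinger perturbation of a transition density `k` by a potential `q`. -/
def pert (d : ℕ) (k : ℝ → Ed d → Ed d → ℝ) (q : Ed d → ℝ) (t : ℝ) (x y : Ed d) : ℝ :=
  ∑' n : ℕ, pertN d k q n t x y

/-- Radial profile of the potential `V_β`. -/
def VProf (d : ℕ) (α β r : ℝ) : ℝ :=
  2 ^ (α / 2) * Real.Gamma (((d : ℝ) - β) / 2) / Real.Gamma (((d : ℝ) - β - α) / 2) *
    (besselK ((β + α) / 2) r / besselK (β / 2) r) * r ^ (-(α / 2))

/-- The potential `V_β(x)`. -/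
def Vbeta (d : ℕ) (α β : ℝ) (x : Ed d) : ℝ := VProf d α β ‖x‖

/-- The Hardy constant `κ_β` for the fractional Laplacian. -/
def kappa (d : ℕ) (α β : ℝ) : ℝ :=
  2 ^ α * Real.Gamma ((β + α) / 2) * Real.Gamma (((d : ℝ) - β) / 2) /
    (Real.Gamma (β / 2) * Real.Gamma (((d : ℝ) - β - α) / 2))

/-- `h^m_β(x) = ∫_0^∞ t^{(d-α-β)/α} p^m(t,x,0) dt`. -/
def hBetaM (d : ℕ) (α m β : ℝ) (x : Ed d) : ℝ :=
  ∫ t in Ioi (0 : ℝ), t ^ (((d : ℝ) - α - β) / α) * relKernel d α m t x 0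

/-- `h_β = h^1_β`. -/
def hBeta (d : ℕ) (α β : ℝ) (x : Ed d) : ℝ := hBetaM d α 1 β x

/-- `V^m_β(x) = ((d-α-β)/α) h^m_{β+α}(x)/h^m_β(x)`. -/
def VbetaM (d : ℕ) (α m β : ℝ) (x : Ed d) : ℝ :=
  (((d : ℝ) - α - β) / α) * hBetaM d α m (β + α) x / hBetaM d α m β x

/-- The function `H⁰(t,x)`. -/
def Hzero (d : ℕ) (α δ t : ℝ) (x : Ed d) : ℝ :=
  if δ ≤ ((d : ℝ) - α) / 2 then 1 + t ^ (δ / α) * ‖x‖ ^ (-δ)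
  else 1 + t ^ (((d : ℝ) - α - δ) / α) * ‖x‖ ^ (-((d : ℝ) - α - δ))

/-- Density of the Lévy measure of the relativistic `α`-stable operator (mass 1). -/
def levyNu (d : ℕ) (α : ℝ) (x : Ed d) : ℝ :=
  2 ^ ((α - (d : ℝ)) / 2 + 1) * π ^ (-(d : ℝ) / 2) * |Real.Gamma (-α / 2)|⁻¹ *
    besselK (((d : ℝ) + α) / 2) ‖x‖ / ‖x‖ ^ (((d : ℝ) + α) / 2)

namespace S18

lemma rpow_mul_exp_bdd {q c : ℝ} (hq : 0 < q) (hc : 0 < c) :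
    ∃ K : ℝ, 0 < K ∧ ∀ y : ℝ, 0 < y → y ^ q * Real.exp (-(c * y)) ≤ K := by
  refine ⟨(q / c) ^ q, by positivity, fun y hy => ?_⟩
  have h1 : c * y / q ≤ Real.exp (c * y / q) := by
    linarith [Real.add_one_le_exp (c * y / q)]
  have h2 : (c * y / q) ^ q ≤ Real.exp (c * y) := by
    calc (c * y / q) ^ q ≤ (Real.exp (c * y / q)) ^ q :=
          Real.rpow_le_rpow (by positivity) h1 hq.le
      _ = Real.exp (c * y) := by
          rw [← Real.exp_mul]; congr 1; field_simp
  have h3 : y ^ q = (q / c) ^ q * (c * y / q) ^ q := by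
    rw [← Real.mul_rpow (by positivity) (by positivity)]; congr 1; field_simp
  rw [h3, mul_assoc, Real.exp_neg]
  have : (c * y / q) ^ q * (Real.exp (c * y))⁻¹ ≤ 1 := by
    rw [mul_inv_le_iff₀ (Real.exp_pos _)]; simpa using h2
  calc _ ≤ (q / c) ^ q * 1 := by gcongr
    _ = _ := mul_one _

lemma integrable_gauss (d : ℕ) {b : ℝ} (hb : 0 < b) :
    Integrable (fun z : Ed d => Real.exp (-b * ‖z‖ ^ 2)) := by
  have h := (GaussianFourier.integrable_cexp_neg_mul_sq_norm_add (V := Ed d) (b := (b : ℂ))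
    (by simpa using hb) 0 0).norm
  refine h.congr (Eventually.of_forall fun z => ?_)
  simp [Complex.norm_exp, ← Complex.ofReal_pow]

lemma gauss_cos (d : ℕ) {b : ℝ} (hb : 0 < b) (x : Ed d) :
    ∫ z : Ed d, Real.cos ⟪x, z⟫ * Real.exp (-b * ‖z‖ ^ 2)
      = (π / b) ^ ((d : ℝ) / 2) * Real.exp (-‖x‖ ^ 2 / (4 * b)) := by
  have h := GaussianFourier.integral_cexp_neg_mul_sq_norm_add (V := Ed d) (b := (b : ℂ))
    (by simpa using hb) Complex.I x
  have hi := (GaussianFourier.integrable_cexp_neg_mul_sq_norm_add (V := Ed d) (b := (b : ℂ))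
    (by simpa using hb) Complex.I x)
  have h2 := congrArg Complex.re h
  rw [← RCLike.re_eq_complex_re, ← integral_re hi] at h2
  have e1 : ∀ z : Ed d, RCLike.re (Complex.exp (-(b : ℂ) * (‖z‖ : ℂ) ^ 2 + Complex.I * ((inner ℝ x z : ℝ) : ℂ)))
     = Real.cos ⟪x, z⟫ * Real.exp (-b * ‖z‖ ^ 2) := by
    intro z
    rw [RCLike.re_eq_complex_re, Complex.exp_re]
    simp [← Complex.ofReal_pow, mul_comm]
  simp_rw [e1] at h2
  rw [h2]
  have e2 : ((π : ℂ) / (b : ℂ)) ^ ((Module.finrank ℝ (Ed d) : ℂ) / 2) * Complex.exp (Complex.I ^ 2 * (‖x‖ : ℂ) ^ 2 / (4 * b))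
     = (((π / b) ^ ((d : ℝ) / 2) * Real.exp (-‖x‖ ^ 2 / (4 * b)) : ℝ) : ℂ) := by
    push_cast [Complex.ofReal_cpow (show 0 ≤ π / b by positivity)]
    simp
  rw [e2, RCLike.re_eq_complex_re, Complex.ofReal_re]

/-- one plus the square of the norm. -/
def Lam {d : ℕ} (z : Ed d) : ℝ := ‖z‖ ^ 2 + 1

lemma one_le_Lam {d : ℕ} (z : Ed d) : 1 ≤ Lam z := by
  unfold Lam; nlinarith [sq_nonneg ‖z‖]

lemma Lam_pos {d : ℕ} (z : Ed d) : 0 < Lam z := lt_of_lt_of_le one_pos (one_le_Lam z)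

lemma continuous_Lam {d : ℕ} : Continuous (Lam : Ed d → ℝ) := by
  unfold Lam; fun_prop

lemma measurable_Lam {d : ℕ} : Measurable (Lam : Ed d → ℝ) := continuous_Lam.measurable

/-- cosine transform. -/
def F {d : ℕ} (φ : ℝ → ℝ) (x : Ed d) : ℝ := ∫ z : Ed d, Real.cos ⟪x, z⟫ * φ (Lam z)

lemma integrable_expLam (d : ℕ) {b : ℝ} (hb : 0 < b) :
    Integrable (fun z : Ed d => Real.exp (-b * Lam z)) := by
  have : (fun z : Ed d => Real.exp (-b * Lam z)) = fun z => Real.exp (-b) * Real.exp (-b * ‖z‖ ^ 2) := by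
    ext z; rw [← Real.exp_add]; congr 1; unfold Lam; ring
  rw [this]; exact (integrable_gauss d hb).const_mul _

lemma F_exp (d : ℕ) {b : ℝ} (hb : 0 < b) (x : Ed d) :
    F (fun l => Real.exp (-b * l)) x =
      Real.exp (-b) * ((π / b) ^ ((d : ℝ) / 2) * Real.exp (-‖x‖ ^ 2 / (4 * b))) := by
  rw [← gauss_cos d hb, ← integral_const_mul]
  unfold F; congr 1; ext z; beta_reduce
  have : Real.exp (-b * Lam z) = Real.exp (-b) * Real.exp (-b * ‖z‖ ^ 2) := by
    rw [← Real.exp_add]; congr 1; unfold Lam; ring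
  rw [this]; ring

lemma F_exp_bdd (d : ℕ) (hd : 0 < d) (x : Ed d) (hx : x ≠ 0) :
    ∃ G : ℝ, 0 < G ∧ ∀ b : ℝ, 0 < b → 0 ≤ F (fun l => Real.exp (-b * l)) x ∧
      F (fun l => Real.exp (-b * l)) x ≤ G := by
  have hx' : 0 < ‖x‖ := norm_pos_iff.2 hx
  have hd' : (0:ℝ) < d := by exact_mod_cast hd
  obtain ⟨K, hK, h⟩ := rpow_mul_exp_bdd (q := (d : ℝ) / 2) (c := ‖x‖ ^ 2 / (4 * π))
    (by positivity) (by positivity)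
  refine ⟨K, hK, fun b hb => ?_⟩
  rw [F_exp d hb]
  refine ⟨by positivity, ?_⟩
  have h1 := h (π / b) (by positivity)
  have : -(‖x‖ ^ 2 / (4 * π) * (π / b)) = -‖x‖ ^ 2 / (4 * b) := by
    field_simp
  rw [this] at h1
  calc _ ≤ 1 * ((π / b) ^ ((d : ℝ) / 2) * Real.exp (-‖x‖ ^ 2 / (4 * b))) := by
        gcongr; exact Real.exp_le_one_iff.2 (by linarith)
    _ ≤ K := by simpa using h1

/-- Uniform bounds for the transform of `φ` damped by exponentials. -/
def Q {d : ℕ} (x : Ed d) (C : ℝ) (φ : ℝ → ℝ) : Prop :=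
  Measurable φ ∧ (∃ M, ∀ l, 1 ≤ l → |φ l| ≤ M) ∧
    ∀ b : ℝ, 0 < b → 0 ≤ F (fun l => φ l * Real.exp (-b * l)) x ∧
      F (fun l => φ l * Real.exp (-b * l)) x ≤ C

/-- Laplace transform of a measure -/
def LT (ν : Measure ℝ) (l : ℝ) : ℝ := ∫ u, Real.exp (-u * l) ∂ν

lemma LT_nonneg {ν : Measure ℝ} (l : ℝ) : 0 ≤ LT ν l := integral_nonneg fun _ => (Real.exp_pos _).le

lemma LT_le {ν : Measure ℝ} [IsFiniteMeasure ν] (hν : ∀ᵐ u ∂ν, 0 ≤ u) {l : ℝ} (hl : 0 ≤ l) : LT ν l ≤ ν.real univ := by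
  have : ν.real univ = ∫ _, (1:ℝ) ∂ν := by simp
  rw [this]
  refine integral_mono_of_nonneg (Eventually.of_forall fun u => (Real.exp_pos _).le)
    (integrable_const _) ?_
  filter_upwards [hν] with u hu
  exact Real.exp_le_one_iff.2 (by nlinarith)

lemma LT_meas {ν : Measure ℝ} [IsFiniteMeasure ν] : Measurable (LT ν) := by
  have : StronglyMeasurable (fun l => ∫ u, Real.exp (-u * l) ∂ν) :=
    StronglyMeasurable.integral_prod_right (f := fun l u => Real.exp (-u * l))
      (Measurable.stronglyMeasurable (by unfold Function.uncurry; fun_prop))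
  exact this.measurable

lemma cos_meas {d : ℕ} (x : Ed d) : Measurable (fun z : Ed d => Real.cos ⟪x, z⟫) := by
  have : Continuous (fun z : Ed d => Real.cos ⟪x, z⟫) := by fun_prop
  exact this.measurable

lemma Q_mul {d : ℕ} {ν : Measure ℝ} [IsFiniteMeasure ν] (hν : ∀ᵐ u ∂ν, 0 ≤ u) {x : Ed d} {C : ℝ} {φ : ℝ → ℝ} (h : Q x C φ) :
    Q x (C * ν.real univ) (fun l => φ l * LT ν l) := by
  obtain ⟨hm, ⟨M, hM⟩, hb⟩ := h
  have hM0 : 0 ≤ M := (abs_nonneg _).trans (hM 1 le_rfl)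
  refine ⟨hm.mul LT_meas, ⟨M * ν.real univ, fun l hl => ?_⟩, fun b hb0 => ?_⟩
  · rw [abs_mul, abs_of_nonneg (LT_nonneg l)]
    exact mul_le_mul (hM l hl) (LT_le hν (by linarith)) (LT_nonneg l) hM0
  · have key : F (fun l => φ l * LT ν l * Real.exp (-b * l)) x
        = ∫ u, F (fun l => φ l * Real.exp (-(b + u) * l)) x ∂ν := by
      unfold F
      rw [← integral_integral_swap]
      · congr 1; ext z
        have : ∀ u, Real.cos ⟪x, z⟫ * (φ (Lam z) * Real.exp (-(b + u) * Lam z))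
          = Real.cos ⟪x, z⟫ * (φ (Lam z) * Real.exp (-b * Lam z)) * Real.exp (-u * Lam z) := by
          intro u
          rw [show -(b + u) * Lam z = -b * Lam z + -u * Lam z by ring, Real.exp_add]; ring
        simp_rw [this, integral_const_mul, LT]
        ring
      · have hdom : Integrable (fun p : Ed d × ℝ => (M * Real.exp (-b * Lam p.1)) * (1:ℝ))
            ((volume : Measure (Ed d)).prod ν) :=
          Integrable.mul_prod ((integrable_expLam d hb0).const_mul M) (integrable_const (1:ℝ))
        refine hdom.mono' ?_ ?_
        · refine Measurable.aestronglyMeasurable ?_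
          unfold Function.uncurry
          have h1 := (cos_meas x).comp (measurable_fst : Measurable (Prod.fst : Ed d × ℝ → _))
          have h2 := (hm.comp measurable_Lam).comp (measurable_fst : Measurable (Prod.fst : Ed d × ℝ → _))
          have h3 : Measurable (fun p : Ed d × ℝ => Lam p.1) := measurable_Lam.comp measurable_fst
          exact h1.mul (h2.mul (Real.measurable_exp.comp
            (((measurable_const.add measurable_snd).neg).mul h3)))
        · have h0 : ∀ᵐ p ∂((volume : Measure (Ed d)).prod ν), 0 ≤ p.2 :=
            Measure.quasiMeasurePreserving_snd.ae hν
          filter_upwards [h0] with p hp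
          unfold Function.uncurry
          rw [Real.norm_eq_abs, abs_mul, abs_mul, Real.abs_exp, mul_one]
          calc |Real.cos ⟪x, p.1⟫| * (|φ (Lam p.1)| * Real.exp (-(b + p.2) * Lam p.1))
              ≤ 1 * (M * Real.exp (-b * Lam p.1)) := by
                gcongr
                · exact Real.abs_cos_le_one _
                · exact hM _ (one_le_Lam _)
                · exact (Lam_pos _).le
                · linarith
            _ = _ := one_mul _
    rw [key]
    constructor
    · refine integral_nonneg_of_ae ?_
      filter_upwards [hν] with u hu
      exact (hb (b + u) (by linarith)).1
    · calc _ ≤ ∫ _, C ∂ν := by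
            refine integral_mono_of_nonneg ?_ (integrable_const _) ?_
            · filter_upwards [hν] with u hu
              exact (hb (b + u) (by linarith)).1
            · filter_upwards [hν] with u hu
              exact (hb (b + u) (by linarith)).2
        _ = _ := by simp [mul_comm]

lemma Q_pow {d : ℕ} {ν : Measure ℝ} [IsFiniteMeasure ν] (hν : ∀ᵐ u ∂ν, 0 ≤ u) {x : Ed d} {C : ℝ} (h : Q x C (fun _ => 1)) (n : ℕ) :
    Q x (C * ν.real univ ^ n) (fun l => LT ν l ^ n) := by
  induction n with
  | zero => simpa using h
  | succ n ih =>
    have := Q_mul hν ih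
    simpa only [pow_succ, mul_assoc] using this

lemma F_exp_LT {d : ℕ} {ν : Measure ℝ} [IsFiniteMeasure ν] (hν : ∀ᵐ u ∂ν, 0 ≤ u) {x : Ed d} {C : ℝ} (h : Q x C (fun _ => 1)) {s b : ℝ} (hs : 0 < s) (hb : 0 < b) :
    0 ≤ F (fun l => Real.exp (-s * (ν.real univ - LT ν l)) * Real.exp (-b * l)) x ∧
    F (fun l => Real.exp (-s * (ν.real univ - LT ν l)) * Real.exp (-b * l)) x ≤ C := by
  set m := ν.real univ with hm
  have hm0 : 0 ≤ m := measureReal_nonneg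
  let f : ℕ → Ed d → ℝ := fun n z =>
    (s ^ n / n.factorial) * (Real.cos ⟪x, z⟫ * (LT ν (Lam z) ^ n * Real.exp (-b * Lam z)))
  have hfm : ∀ n, AEStronglyMeasurable (f n) := by
    intro n
    refine Measurable.aestronglyMeasurable ?_
    exact ((cos_meas x).mul (((LT_meas.comp measurable_Lam).pow_const n).mul
      (Real.measurable_exp.comp (measurable_Lam.const_mul _)))).const_mul _
  have hbd : ∀ n z, ‖f n z‖ ≤ (s * m) ^ n / n.factorial * Real.exp (-b * Lam z) := by
    intro n z
    simp only [f]
    rw [Real.norm_eq_abs, abs_mul, abs_mul, abs_mul, Real.abs_exp, abs_of_nonneg (by positivity),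
      abs_of_nonneg (pow_nonneg (LT_nonneg _) n), mul_pow]
    calc s ^ n / n.factorial * (|Real.cos ⟪x, z⟫| * (LT ν (Lam z) ^ n * Real.exp (-b * Lam z)))
        ≤ s ^ n / n.factorial * (1 * (m ^ n * Real.exp (-b * Lam z))) := by
          gcongr
          · exact mul_nonneg (pow_nonneg (LT_nonneg _) n) (Real.exp_pos _).le
          · exact Real.abs_cos_le_one _
          · exact LT_nonneg _
          · exact LT_le hν (Lam_pos z).le
      _ = _ := by ring
  have hI := integrable_expLam d hb
  have hfi : ∀ n, Integrable (f n) := fun n =>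
    (hI.const_mul _).mono' (hfm n) (Eventually.of_forall (hbd n))
  have hsum : Summable fun n => ∫ z, ‖f n z‖ := by
    refine Summable.of_nonneg_of_le (fun n => integral_nonneg fun _ => norm_nonneg _)
      (fun n => integral_mono (hfi n).norm (hI.const_mul _) (hbd n)) ?_
    simp_rw [integral_const_mul]
    exact (Real.summable_pow_div_factorial _).mul_right _
  have H := hasSum_integral_of_summable_integral_norm hfi hsum
  have e1 : ∀ z, ∑' n, f n z = Real.cos ⟪x, z⟫ * (Real.exp (s * LT ν (Lam z)) * Real.exp (-b * Lam z)) := by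
    intro z
    have h1 : HasSum (fun n : ℕ => (s * LT ν (Lam z)) ^ n / n.factorial) (Real.exp (s * LT ν (Lam z))) := by
      rw [Real.exp_eq_exp_ℝ]
      exact NormedSpace.expSeries_div_hasSum_exp (s * LT ν (Lam z))
    have h2 := h1.mul_right (Real.cos ⟪x, z⟫ * Real.exp (-b * Lam z))
    rw [← mul_assoc, mul_comm (Real.cos _), mul_assoc, ← h2.tsum_eq]
    congr 1; ext n; simp only [f, mul_pow]; ring
  simp_rw [e1] at H
  have e2 : F (fun l => Real.exp (-s * (m - LT ν l)) * Real.exp (-b * l)) x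
     = Real.exp (-s * m) * ∫ z, Real.cos ⟪x, z⟫ * (Real.exp (s * LT ν (Lam z)) * Real.exp (-b * Lam z)) := by
    unfold F
    rw [← integral_const_mul]
    congr 1; ext z; beta_reduce
    rw [show -s * (m - LT ν (Lam z)) = -s * m + s * LT ν (Lam z) by ring, Real.exp_add]; ring
  have hq : ∀ n, 0 ≤ ∫ z, f n z ∧ ∫ z, f n z ≤ C * ((s * m) ^ n / n.factorial) := by
    intro n
    have hq := (Q_pow hν h n).2.2 b hb
    simp only [f, integral_const_mul]
    unfold F at hq
    constructor
    · exact mul_nonneg (by positivity) hq.1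
    · calc _ ≤ s ^ n / n.factorial * (C * m ^ n) := by gcongr; exact hq.2
        _ = _ := by rw [mul_pow]; ring
  have h1 : HasSum (fun n : ℕ => C * ((s * m) ^ n / n.factorial)) (C * Real.exp (s * m)) := by
    rw [Real.exp_eq_exp_ℝ]
    exact (NormedSpace.expSeries_div_hasSum_exp (s * m)).mul_left C
  rw [e2]
  constructor
  · exact mul_nonneg (Real.exp_pos _).le (H.nonneg fun n => (hq n).1)
  · have := hasSum_le (fun n => (hq n).2) H h1
    calc _ ≤ Real.exp (-s * m) * (C * Real.exp (s * m)) := by gcongr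
      _ = C := by
        rw [mul_left_comm, ← Real.exp_add]; simp

lemma levy_int {a l : ℝ} (ha : a ∈ Ioo (0:ℝ) 1) (hl : 0 < l) :
    IntegrableOn (fun u => (1 - Real.exp (-u * l)) * u ^ (-1 - a)) (Ioi 0) := by
  obtain ⟨ha0, ha1⟩ := ha
  have hmeas : Measurable (fun u : ℝ => (1 - Real.exp (-u * l)) * u ^ (-1 - a)) := by fun_prop
  rw [← Ioc_union_Ioi_eq_Ioi zero_le_one]
  refine IntegrableOn.union ?_ ?_
  · have h : IntegrableOn (fun u : ℝ => l * u ^ (-a)) (Ioc 0 1) :=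
      ((intervalIntegral.intervalIntegrable_rpow' (a := 0) (b := 1) (r := -a)
        (by linarith)).const_mul l).1
    refine h.mono' hmeas.aestronglyMeasurable ?_
    filter_upwards [ae_restrict_mem measurableSet_Ioc] with u hu
    have h1 : Real.exp (-u * l) ≤ 1 := Real.exp_le_one_iff.2 (by nlinarith [hu.1])
    have h2 := Real.add_one_le_exp (-u * l)
    have h3 : 0 ≤ u ^ (-1 - a) := Real.rpow_nonneg hu.1.le _
    rw [Real.norm_eq_abs, abs_of_nonneg (mul_nonneg (by linarith) h3)]
    calc _ ≤ (u * l) * u ^ (-1 - a) := by gcongr; linarith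
      _ = l * u ^ (-a) := by
        rw [show -a = 1 + (-1 - a) by ring, Real.rpow_add hu.1 1, Real.rpow_one]; ring
  · have h : IntegrableOn (fun u : ℝ => u ^ (-1 - a)) (Ioi 1) :=
      integrableOn_Ioi_rpow_of_lt (by linarith) one_pos
    refine h.mono' hmeas.aestronglyMeasurable ?_
    filter_upwards [ae_restrict_mem measurableSet_Ioi] with u hu
    have hu0 : 0 < u := lt_trans one_pos hu
    have h1 : Real.exp (-u * l) ≤ 1 := Real.exp_le_one_iff.2 (by nlinarith)
    have h2 := Real.exp_pos (-u * l)
    have h3 : 0 ≤ u ^ (-1 - a) := Real.rpow_nonneg hu0.le _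
    rw [Real.norm_eq_abs, abs_of_nonneg (mul_nonneg (by linarith) h3)]
    calc _ ≤ 1 * u ^ (-1 - a) := by gcongr; linarith
      _ = _ := one_mul _

lemma levy_scale {a l : ℝ} (hl : 0 < l) :
    ∫ u in Ioi (0:ℝ), (1 - Real.exp (-u * l)) * u ^ (-1 - a) =
      l ^ a * ∫ u in Ioi (0:ℝ), (1 - Real.exp (-u)) * u ^ (-1 - a) := by
  have h := integral_comp_mul_left_Ioi (fun u => (1 - Real.exp (-u)) * u ^ (-1 - a)) 0 hl
  rw [mul_zero] at h
  have e : ∫ u in Ioi (0:ℝ), (1 - Real.exp (-(l * u))) * (l * u) ^ (-1 - a)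
      = l ^ (-1 - a) * ∫ u in Ioi (0:ℝ), (1 - Real.exp (-u * l)) * u ^ (-1 - a) := by
    rw [← integral_const_mul]
    refine setIntegral_congr_fun measurableSet_Ioi fun u hu => ?_
    rw [Real.mul_rpow hl.le (le_of_lt hu), show -(l * u) = -u * l by ring]; ring
  rw [e] at h
  have h2 : l ^ (1 + a) * l ^ (-1 - a) = 1 := by
    rw [← Real.rpow_add hl]; simp
  have h3 : l ^ (1 + a) * l⁻¹ = l ^ a := by
    rw [Real.rpow_add hl, Real.rpow_one]; field_simp
  calc _ = l ^ (1 + a) * (l ^ (-1 - a) * ∫ u in Ioi (0:ℝ), (1 - Real.exp (-u * l)) * u ^ (-1 - a)) := by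
        rw [← mul_assoc, h2, one_mul]
    _ = _ := by rw [h, smul_eq_mul, ← mul_assoc, h3]

lemma levy_pos {a : ℝ} (ha : a ∈ Ioo (0:ℝ) 1) :
    0 < ∫ u in Ioi (0:ℝ), (1 - Real.exp (-u)) * u ^ (-1 - a) := by
  have hi := levy_int ha one_pos
  simp only [mul_one] at hi
  rw [setIntegral_pos_iff_support_of_nonneg_ae]
  · have : Ioi (0:ℝ) ⊆ Function.support (fun u : ℝ => (1 - Real.exp (-u)) * u ^ (-1 - a)) ∩ Ioi 0 := by
      intro u hu
      refine ⟨?_, hu⟩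
      have hu' : 0 < u := hu
      have h1 : Real.exp (-u) < 1 := Real.exp_lt_one_iff.2 (by linarith)
      have h3 : 0 < u ^ (-1 - a) := Real.rpow_pos_of_pos hu' _
      exact (mul_pos (by linarith) h3).ne'
    exact lt_of_lt_of_le (by simp) (measure_mono this)
  · filter_upwards [ae_restrict_mem measurableSet_Ioi] with u hu
    have hu' : 0 < u := hu
    have h1 : Real.exp (-u) < 1 := Real.exp_lt_one_iff.2 (by linarith)
    have h3 : 0 < u ^ (-1 - a) := Real.rpow_pos_of_pos hu' _
    exact (mul_pos (by linarith) h3).le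
  · exact hi

lemma exists_levy {a : ℝ} (ha : a ∈ Ioo (0:ℝ) 1) : ∃ B : ℝ, 0 < B ∧ ∀ ε : ℝ, 0 < ε →
    ∃ ν : Measure ℝ, IsFiniteMeasure ν ∧ (∀ᵐ u ∂ν, 0 ≤ u) ∧
      ∀ l : ℝ, 0 < l → l ^ a - B * ε ^ (1 - a) * l ≤ ν.real univ - LT ν l ∧
        ν.real univ - LT ν l ≤ l ^ a := by
  have ha' := ha
  obtain ⟨ha0, ha1⟩ := ha'
  set I1 := ∫ u in Ioi (0:ℝ), (1 - Real.exp (-u)) * u ^ (-1 - a) with hI1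
  have hI : 0 < I1 := levy_pos ha
  refine ⟨I1⁻¹ / (1 - a), div_pos (inv_pos.2 hI) (by linarith), fun ε hε => ?_⟩
  have hIntg : IntegrableOn (fun u : ℝ => I1⁻¹ * u ^ (-1 - a)) (Ioi ε) :=
    (integrableOn_Ioi_rpow_of_lt (by linarith) hε).const_mul _
  let ν := (volume.restrict (Ioi ε)).withDensity (fun u => ENNReal.ofReal (I1⁻¹ * u ^ (-1 - a)))
  have hfin : IsFiniteMeasure ν := isFiniteMeasure_withDensity_ofReal hIntg.2
  have hdens : Measurable (fun u : ℝ => ENNReal.ofReal (I1⁻¹ * u ^ (-1 - a))) := by fun_prop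
  have hnn : ∀ᵐ u ∂ν, 0 ≤ u := by
    refine (withDensity_absolutelyContinuous _ _).ae_le ?_
    filter_upwards [ae_restrict_mem measurableSet_Ioi] with u hu
    exact (hε.trans hu).le
  refine ⟨ν, hfin, hnn, fun l hl => ?_⟩
  have hexp : Integrable (fun u => Real.exp (-u * l)) ν := by
    refine (integrable_const (1:ℝ)).mono' (by fun_prop) ?_
    filter_upwards [hnn] with u hu
    rw [Real.norm_eq_abs, Real.abs_exp]
    exact Real.exp_le_one_iff.2 (by nlinarith)
  have e1 : ν.real univ - LT ν l = I1⁻¹ * ∫ u in Ioi ε, (1 - Real.exp (-u * l)) * u ^ (-1 - a) := by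
    have : ν.real univ = ∫ _, (1:ℝ) ∂ν := by simp
    rw [this, LT, ← integral_sub (integrable_const _) hexp,
      integral_withDensity_eq_integral_toReal_smul hdens (by simp), ← integral_const_mul]
    refine setIntegral_congr_fun measurableSet_Ioi fun u hu => ?_
    have hu0 : 0 < u := hε.trans hu
    rw [ENNReal.toReal_ofReal (by positivity), smul_eq_mul]; ring
  have hli := levy_int ha hl
  have e2 : l ^ a = I1⁻¹ * ∫ u in Ioi (0:ℝ), (1 - Real.exp (-u * l)) * u ^ (-1 - a) := by
    rw [levy_scale hl, ← hI1]; field_simp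
  have e3 : ∫ u in Ioi (0:ℝ), (1 - Real.exp (-u * l)) * u ^ (-1 - a)
     = (∫ u in Ioc (0:ℝ) ε, (1 - Real.exp (-u * l)) * u ^ (-1 - a)) +
      ∫ u in Ioi ε, (1 - Real.exp (-u * l)) * u ^ (-1 - a) := by
    rw [← setIntegral_union (Ioc_disjoint_Ioi le_rfl) measurableSet_Ioi
      (hli.mono_set Ioc_subset_Ioi_self) (hli.mono_set (Ioi_subset_Ioi hε.le)),
      Ioc_union_Ioi_eq_Ioi hε.le]
  have h0 : 0 ≤ ∫ u in Ioc (0:ℝ) ε, (1 - Real.exp (-u * l)) * u ^ (-1 - a) := by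
    refine setIntegral_nonneg measurableSet_Ioc fun u hu => ?_
    have h1 : Real.exp (-u * l) ≤ 1 := Real.exp_le_one_iff.2 (by nlinarith [hu.1])
    exact mul_nonneg (by linarith) (Real.rpow_nonneg hu.1.le _)
  have h1 : ∫ u in Ioc (0:ℝ) ε, (1 - Real.exp (-u * l)) * u ^ (-1 - a) ≤ l * (ε ^ (1 - a) / (1 - a)) := by
    have e4 : ∫ u in Ioc (0:ℝ) ε, l * u ^ (-a) = l * (ε ^ (1 - a) / (1 - a)) := by
      rw [integral_const_mul, ← intervalIntegral.integral_of_le hε.le,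
        integral_rpow (Or.inl (by linarith)), show -a + 1 = 1 - a by ring,
        Real.zero_rpow (by linarith), sub_zero]
    rw [← e4]
    refine setIntegral_mono_on (hli.mono_set Ioc_subset_Ioi_self)
      ((intervalIntegral.intervalIntegrable_rpow' (a := 0) (b := ε) (r := -a)
        (by linarith)).const_mul l).1 measurableSet_Ioc fun u hu => ?_
    have h2 := Real.add_one_le_exp (-u * l)
    have h3 : 0 ≤ u ^ (-1 - a) := Real.rpow_nonneg hu.1.le _
    calc _ ≤ (u * l) * u ^ (-1 - a) := by gcongr; linarith
      _ = l * u ^ (-a) := by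
        rw [show -a = 1 + (-1 - a) by ring, Real.rpow_add hu.1 1, Real.rpow_one]; ring
  rw [e1, e2, e3]
  have hIi : 0 < I1⁻¹ := inv_pos.2 hI
  constructor
  · have := mul_le_mul_of_nonneg_left h1 hIi.le
    have e5 : I1⁻¹ / (1 - a) * ε ^ (1 - a) * l = I1⁻¹ * (l * (ε ^ (1 - a) / (1 - a))) := by ring
    rw [e5]; linarith
  · have := mul_nonneg hIi.le h0
    linarith

/-- The unnormalised kernel -/
def P {d : ℕ} (a s : ℝ) (x : Ed d) : ℝ := F (fun l => Real.exp (-s * l ^ a)) x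

lemma integrable_f (d : ℕ) {a s : ℝ} (ha : 0 < a) (hs : 0 < s) :
    Integrable (fun z : Ed d => Real.exp (-s * Lam z ^ a)) := by
  obtain ⟨K, hK, h⟩ := rpow_mul_exp_bdd (q := (((d:ℝ) + 1) / 2) / a) (c := s)
    (by positivity) hs
  have hi : Integrable (fun z : Ed d => (1 + ‖z‖ ^ 2) ^ (-((d:ℝ) + 1) / 2)) :=
    integrable_rpow_neg_one_add_norm_sq (by simp)
  refine (hi.const_mul K).mono' ?_ (Eventually.of_forall fun z => ?_)
  · exact (Real.measurable_exp.comp ((measurable_Lam.pow_const a).const_mul _)).aestronglyMeasurable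
  · have hL := Lam_pos z
    have h1 := h (Lam z ^ a) (by positivity)
    rw [← Real.rpow_mul hL.le] at h1
    have : a * (((d:ℝ) + 1) / 2 / a) = ((d:ℝ) + 1) / 2 := by field_simp
    rw [this] at h1
    rw [Real.norm_eq_abs, Real.abs_exp, neg_mul, show 1 + ‖z‖ ^ 2 = Lam z by unfold Lam; ring,
      neg_div, Real.rpow_neg hL.le, ← div_eq_mul_inv, le_div_iff₀ (by positivity)]
    linarith

lemma P_bdd {d : ℕ} (hd : 0 < d) {a : ℝ} (ha : a ∈ Ioo (0:ℝ) 1) (x : Ed d) (hx : x ≠ 0) :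
    ∃ G : ℝ, 0 < G ∧ ∀ s : ℝ, 0 < s → 0 ≤ P a s x ∧ P a s x ≤ G := by
  obtain ⟨G, hG, hGb⟩ := F_exp_bdd d hd x hx
  refine ⟨G, hG, fun s hs => ?_⟩
  have hQ : Q x G (fun _ => 1) := by
    refine ⟨measurable_const, ⟨1, fun l _ => by simp⟩, fun b hb => ?_⟩
    simpa using hGb b hb
  obtain ⟨B, hB, hν⟩ := exists_levy ha
  have hε : ∀ n : ℕ, (0:ℝ) < 1 / ((n:ℝ) + 1) := fun n => by positivity
  choose ν hfin hnn hl using fun n : ℕ => hν (1 / ((n:ℝ) + 1)) (hε n)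
  let b : ℕ → ℝ := fun n => B * (1 / ((n:ℝ) + 1)) ^ (1 - a)
  have hb0 : ∀ n, 0 < b n := fun n => mul_pos hB (Real.rpow_pos_of_pos (hε n) _)
  have hbt : Tendsto b atTop (nhds 0) := by
    have h1 := (tendsto_one_div_add_atTop_nhds_zero_nat (𝕜 := ℝ)).rpow_const
      (p := 1 - a) (Or.inr (by linarith [ha.2]))
    rw [Real.zero_rpow (by linarith [ha.2])] at h1
    have h2 := h1.const_mul B
    rw [mul_zero] at h2
    exact h2
  let φ : ℕ → ℝ → ℝ := fun n l => Real.exp (-s * ((ν n).real univ - LT (ν n) l)) * Real.exp (-(s * b n) * l)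
  have hφ : ∀ n, 0 ≤ F (φ n) x ∧ F (φ n) x ≤ G := fun n => by
    have := hfin n
    exact F_exp_LT (hnn n) hQ hs (mul_pos hs (hb0 n))
  have hlim : Tendsto (fun n => F (φ n) x) atTop (nhds (P a s x)) := by
    unfold P F
    refine tendsto_integral_of_dominated_convergence (fun z => Real.exp (-s * Lam z ^ a)) ?_
      (integrable_f d ha.1 hs) ?_ ?_
    · intro n
      have := hfin n
      refine Measurable.aestronglyMeasurable ?_
      have h1 : Measurable (fun z : Ed d => LT (ν n) (Lam z)) := LT_meas.comp measurable_Lam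
      exact (cos_meas x).mul ((Real.measurable_exp.comp ((h1.const_sub _).const_mul _)).mul
        (Real.measurable_exp.comp (measurable_Lam.const_mul _)))
    · intro n
      refine Eventually.of_forall fun z => ?_
      have h1 := (hl n (Lam z) (Lam_pos z)).1
      simp only [φ]
      rw [norm_mul, ← Real.exp_add, Real.norm_eq_abs, Real.norm_eq_abs, Real.abs_exp]
      calc _ ≤ 1 * Real.exp (-s * ((ν n).real univ - LT (ν n) (Lam z)) + -(s * b n) * Lam z) := by
            gcongr; exact Real.abs_cos_le_one _
        _ ≤ _ := by
            rw [one_mul]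
            apply Real.exp_le_exp.2
            simp only [b]
            nlinarith
    · refine Eventually.of_forall fun z => ?_
      refine Tendsto.const_mul _ ?_
      have h1 : Tendsto (fun n => (ν n).real univ - LT (ν n) (Lam z)) atTop (nhds (Lam z ^ a)) := by
        refine tendsto_of_tendsto_of_tendsto_of_le_of_le (g := fun n => Lam z ^ a - b n * Lam z)
          (h := fun _ => Lam z ^ a) ?_ tendsto_const_nhds
          (fun n => (hl n (Lam z) (Lam_pos z)).1) (fun n => (hl n (Lam z) (Lam_pos z)).2)
        simpa using (hbt.mul_const (Lam z)).const_sub (Lam z ^ a)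
      have h2 : Tendsto (fun n => -(s * b n) * Lam z) atTop (nhds 0) := by
        simpa using ((hbt.const_mul s).neg.mul_const (Lam z))
      have h3 := ((Real.continuous_exp.tendsto _).comp (h1.const_mul (-s))).mul
        ((Real.continuous_exp.tendsto _).comp h2)
      rw [Real.exp_zero, mul_one] at h3
      exact h3
  exact ⟨ge_of_tendsto' hlim fun n => (hφ n).1, le_of_tendsto' hlim fun n => (hφ n).2⟩

lemma P_nonneg {d : ℕ} (hd : 0 < d) {a : ℝ} (ha : a ∈ Ioo (0:ℝ) 1) {s : ℝ} (hs : 0 < s) (x : Ed d) :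
    0 ≤ P a s x := by
  by_cases hx : x = 0
  · subst hx
    refine integral_nonneg fun z => ?_
    simp only [inner_zero_left, Real.cos_zero, one_mul]
    exact (Real.exp_pos _).le
  · obtain ⟨G, _, h⟩ := P_bdd hd ha x hx
    exact (h s hs).1

lemma P_le_exp {d : ℕ} (hd : 0 < d) {a : ℝ} (ha : a ∈ Ioo (0:ℝ) 1) (x : Ed d) (hx : x ≠ 0) :
    ∃ K : ℝ, 0 < K ∧ ∀ s : ℝ, 0 < s → P a s x ≤ K * Real.exp (-s) := by
  obtain ⟨G, hG, h⟩ := P_bdd hd ha x hx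
  set J := ∫ z : Ed d, Real.exp (-1 * Lam z ^ a) with hJ
  have hJ0 : 0 ≤ J := integral_nonneg fun _ => (Real.exp_pos _).le
  refine ⟨(G + J) * Real.exp 1, by positivity, fun s hs => ?_⟩
  rw [mul_assoc, ← Real.exp_add]
  rcases le_or_gt s 1 with h1 | h1
  · have : 1 ≤ Real.exp (1 + -s) := Real.one_le_exp (by linarith)
    have := (h s hs).2
    nlinarith
  · have h2 : P a s x ≤ J * Real.exp (1 + -s) := by
      rw [hJ, ← integral_mul_const]
      refine (le_abs_self _).trans ?_
      rw [← Real.norm_eq_abs]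
      refine norm_integral_le_of_norm_le ((integrable_f d ha.1 one_pos).mul_const _)
        (Eventually.of_forall fun z => ?_)
      rw [norm_mul, Real.norm_eq_abs, Real.norm_eq_abs, Real.abs_exp, ← Real.exp_add]
      calc _ ≤ 1 * Real.exp (-s * Lam z ^ a) := by gcongr; exact Real.abs_cos_le_one _
        _ ≤ _ := by
          rw [one_mul]
          apply Real.exp_le_exp.2
          have : 1 ≤ Lam z ^ a := Real.one_le_rpow (one_le_Lam z) ha.1.le
          nlinarith
    have := Real.exp_pos (1 + -s)
    nlinarith

lemma cont_f (d : ℕ) (a s : ℝ) : Continuous (fun z : Ed d => Real.exp (-s * Lam z ^ a)) :=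
  Real.continuous_exp.comp (continuous_const.mul
    (continuous_Lam.rpow_const fun z => Or.inl (Lam_pos z).ne'))

lemma P_meas (d : ℕ) (a : ℝ) : Measurable (fun p : ℝ × Ed d => P a p.1 p.2) := by
  have : StronglyMeasurable (fun p : ℝ × Ed d => ∫ z : Ed d, Real.cos ⟪p.2, z⟫ * Real.exp (-p.1 * Lam z ^ a)) := by
    refine StronglyMeasurable.integral_prod_right
      (f := fun (p : ℝ × Ed d) (z : Ed d) => Real.cos ⟪p.2, z⟫ * Real.exp (-p.1 * Lam z ^ a)) ?_
    refine Continuous.stronglyMeasurable ?_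
    unfold Function.uncurry
    have h1 : Continuous (fun p : (ℝ × Ed d) × Ed d => Lam p.2 ^ a) :=
      (continuous_Lam.comp continuous_snd).rpow_const fun z => Or.inl (Lam_pos _).ne'
    fun_prop
  exact this.measurable

lemma P_meas_x {d : ℕ} (a s : ℝ) : Measurable (fun x : Ed d => P a s x) := by
  have h : Measurable (fun x : Ed d => ((s, x) : ℝ × Ed d)) := measurable_prodMk_left
  have h2 := Measurable.comp (P_meas d a) h
  exact h2

lemma P_neg {d : ℕ} (a s : ℝ) (x : Ed d) : P a s (-x) = P a s x := by
  unfold P F; simp [inner_neg_left]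

lemma P_gauss {d : ℕ} {a s b : ℝ} (ha : 0 < a) (hs : 0 < s) (hb : 0 < b) :
    Integrable (fun x : Ed d => P a s x * Real.exp (-b * ‖x‖ ^ 2)) ∧
    ∫ x : Ed d, P a s x * Real.exp (-b * ‖x‖ ^ 2) ≤ (4 * π ^ 2) ^ ((d:ℝ) / 2) := by
  have hI : Integrable (fun p : Ed d × Ed d => (Real.cos ⟪p.1, p.2⟫ * Real.exp (-s * Lam p.2 ^ a)) * Real.exp (-b * ‖p.1‖ ^ 2))
      (volume.prod volume) := by
    have h1 := Integrable.mul_prod (integrable_gauss d hb) (integrable_f d ha hs)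
    refine h1.mono' ?_ (Eventually.of_forall fun p => ?_)
    · refine Continuous.aestronglyMeasurable ?_
      have h1 : Continuous (fun p : Ed d × Ed d => Lam p.2 ^ a) :=
        (continuous_Lam.comp continuous_snd).rpow_const fun z => Or.inl (Lam_pos _).ne'
      fun_prop
    · rw [norm_mul, norm_mul, Real.norm_eq_abs, Real.norm_eq_abs, Real.norm_eq_abs,
        Real.abs_exp, Real.abs_exp]
      calc _ ≤ 1 * Real.exp (-s * Lam p.2 ^ a) * Real.exp (-b * ‖p.1‖ ^ 2) := by
            gcongr; exact Real.abs_cos_le_one _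
        _ = _ := by ring
  have e0 : ∀ x : Ed d, P a s x * Real.exp (-b * ‖x‖ ^ 2) =
      ∫ z, (Real.cos ⟪x, z⟫ * Real.exp (-s * Lam z ^ a)) * Real.exp (-b * ‖x‖ ^ 2) := by
    intro x; rw [integral_mul_const]; rfl
  simp_rw [e0]
  refine ⟨hI.integral_prod_left, ?_⟩
  rw [integral_integral_swap (f := fun x z => (Real.cos ⟪x, z⟫ * Real.exp (-s * Lam z ^ a)) * Real.exp (-b * ‖x‖ ^ 2)) hI]
  have e1 : ∀ z : Ed d, ∫ x : Ed d, (Real.cos ⟪x, z⟫ * Real.exp (-s * Lam z ^ a)) * Real.exp (-b * ‖x‖ ^ 2)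
      = Real.exp (-s * Lam z ^ a) * ((π / b) ^ ((d : ℝ) / 2) * Real.exp (-‖z‖ ^ 2 / (4 * b))) := by
    intro z
    rw [← gauss_cos d hb, ← integral_const_mul]
    congr 1; ext x; rw [real_inner_comm]; ring
  simp_rw [e1]
  have e2 : ∀ z : Ed d, Real.exp (-‖z‖ ^ 2 / (4 * b)) = Real.exp (-(1 / (4 * b)) * ‖z‖ ^ 2) := by
    intro z; congr 1; ring
  have hb' : 0 < 1 / (4 * b) := by positivity
  have e3 : ∫ z : Ed d, (π / b) ^ ((d : ℝ) / 2) * Real.exp (-‖z‖ ^ 2 / (4 * b)) = (4 * π ^ 2) ^ ((d:ℝ) / 2) := by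
    simp_rw [e2]
    rw [integral_const_mul, GaussianFourier.integral_rexp_neg_mul_sq_norm hb', finrank_euclideanSpace,
      Fintype.card_fin, ← Real.mul_rpow (by positivity) (by positivity)]
    congr 1; field_simp
  rw [← e3]
  refine integral_mono_of_nonneg (Eventually.of_forall fun z => by positivity) ?_
    (Eventually.of_forall fun z => ?_)
  · simp_rw [e2]; exact (integrable_gauss d hb').const_mul _
  · have h1 : Real.exp (-s * Lam z ^ a) ≤ 1 := by
      refine Real.exp_le_one_iff.2 ?_
      have := Real.rpow_pos_of_pos (Lam_pos z) a
      nlinarith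
    exact mul_le_of_le_one_left (by positivity) h1

lemma P_integrable {d : ℕ} (hd : 0 < d) {a s : ℝ} (ha : a ∈ Ioo (0:ℝ) 1) (hs : 0 < s) :
    Integrable (fun x : Ed d => P a s x) := by
  have hP := fun x : Ed d => P_nonneg hd ha hs x
  refine ⟨(P_meas_x a s).aestronglyMeasurable, ?_⟩
  rw [hasFiniteIntegral_iff_ofReal (Eventually.of_forall hP)]
  let b : ℕ → ℝ := fun n => 1 / ((n:ℝ) + 1)
  have hb0 : ∀ n, 0 < b n := fun n => by simp only [b]; positivity
  have hbt : Tendsto b atTop (nhds 0) := tendsto_one_div_add_atTop_nhds_zero_nat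
  let g : ℕ → Ed d → ENNReal := fun n x => ENNReal.ofReal (P a s x * Real.exp (-b n * ‖x‖ ^ 2))
  have hg : ∀ n, Measurable (g n) := fun n =>
    ((P_meas_x a s).mul (by fun_prop)).ennreal_ofReal
  have h1 := lintegral_liminf_le (u := atTop) (μ := (volume : Measure (Ed d))) hg
  have h2 : ∀ x, liminf (fun n => g n x) atTop = ENNReal.ofReal (P a s x) := by
    intro x
    refine Tendsto.liminf_eq ?_
    refine (ENNReal.continuous_ofReal.tendsto _).comp ?_
    have h3 : Tendsto (fun n => -b n * ‖x‖ ^ 2) atTop (nhds 0) := by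
      simpa using hbt.neg.mul_const (‖x‖ ^ 2)
    have h4 := ((Real.continuous_exp.tendsto _).comp h3).const_mul (P a s x)
    rw [Real.exp_zero, mul_one] at h4
    exact h4
  simp_rw [h2] at h1
  refine lt_of_le_of_lt h1 ?_
  have h5 : ∀ n, ∫⁻ x, g n x ≤ ENNReal.ofReal ((4 * π ^ 2) ^ ((d:ℝ) / 2)) := by
    intro n
    obtain ⟨hi, hle⟩ := P_gauss (d := d) ha.1 hs (hb0 n)
    simp only [g]
    rw [← ofReal_integral_eq_lintegral_ofReal hi
      (Eventually.of_forall fun x => mul_nonneg (hP x) (Real.exp_pos _).le)]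
    exact ENNReal.ofReal_le_ofReal hle
  refine lt_of_le_of_lt (liminf_le_liminf (Eventually.of_forall h5)) ?_
  simp

lemma integral_odd {d : ℕ} (g : Ed d → ℝ) (h : ∀ x, g (-x) = -g x) : ∫ x, g x = 0 := by
  have h1 := integral_neg_eq_self g volume
  simp_rw [h, integral_neg] at h1
  linarith

open FourierTransform in
lemma P_inv {d : ℕ} (hd : 0 < d) {a s : ℝ} (ha : a ∈ Ioo (0:ℝ) 1) (hs : 0 < s) (z : Ed d) :
    ∫ y : Ed d, Real.cos ⟪y, z⟫ * P a s y = (2 * π) ^ d * Real.exp (-s * Lam z ^ a) := by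
  let f : Ed d → ℂ := fun z => ((Real.exp (-s * Lam z ^ a) : ℝ) : ℂ)
  have hf := integrable_f d ha.1 hs
  have hfc : Continuous f := Complex.continuous_ofReal.comp (cont_f d a s)
  have hfi : Integrable f := hf.ofReal
  have hpi : (2 * π) ≠ 0 := by positivity
  have split : ∀ (g : Ed d → ℝ) (w : Ed d) (c : ℝ), Integrable g → (∀ z, g (-z) = g z) →
      ∫ v : Ed d, Complex.exp ((c * ⟪v, w⟫ : ℝ) * Complex.I) • ((g v : ℝ) : ℂ)
        = ((∫ v : Ed d, Real.cos (c * ⟪v, w⟫) * g v : ℝ) : ℂ) := by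
    intro g w c hg hev
    have h1 : ∀ v : Ed d, Complex.exp ((c * ⟪v, w⟫ : ℝ) * Complex.I) • ((g v : ℝ) : ℂ)
        = ((Real.cos (c * ⟪v, w⟫) * g v : ℝ) : ℂ) + ((Real.sin (c * ⟪v, w⟫) * g v : ℝ) : ℂ) * Complex.I := by
      intro v
      rw [Complex.exp_mul_I, smul_eq_mul, ← Complex.ofReal_cos, ← Complex.ofReal_sin]
      push_cast; ring
    have i1 : Integrable (fun v : Ed d => Real.cos (c * ⟪v, w⟫) * g v) := by
      refine hg.bdd_mul (c := 1) (Continuous.aestronglyMeasurable (by fun_prop)) (Eventually.of_forall fun v => ?_)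
      exact Real.abs_cos_le_one _
    have i2 : Integrable (fun v : Ed d => Real.sin (c * ⟪v, w⟫) * g v) := by
      refine hg.bdd_mul (c := 1) (Continuous.aestronglyMeasurable (by fun_prop)) (Eventually.of_forall fun v => ?_)
      exact Real.abs_sin_le_one _
    simp_rw [h1]
    rw [integral_add i1.ofReal (i2.ofReal.mul_const _), integral_mul_const, integral_complex_ofReal,
      integral_complex_ofReal, integral_odd (fun v : Ed d => Real.sin (c * ⟪v, w⟫) * g v)]
    · simp
    · intro v; simp [inner_neg_left, hev]
  have hF : 𝓕 f = fun w => ((P a s ((2 * π) • w) : ℝ) : ℂ) := by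
    ext w
    rw [Real.fourier_eq', split _ w (-2 * π) hf (by intro z; simp [Lam])]
    congr 1
    unfold P F
    congr 1; ext v
    rw [real_inner_smul_left, real_inner_comm v w, show -2 * π * ⟪v, w⟫ = -(2 * π * ⟪v, w⟫) by ring,
      Real.cos_neg]
  have hPi := P_integrable hd ha hs
  have hPi2 : Integrable (fun w : Ed d => P a s ((2 * π) • w)) := hPi.comp_smul hpi
  have hFi : Integrable (𝓕 f) := by rw [hF]; exact hPi2.ofReal
  have hinv := congrFun (hfc.fourierInv_fourier_eq hfi hFi) z
  rw [hF, Real.fourierInv_eq', split _ z (2 * π) hPi2 (by intro w; rw [smul_neg, P_neg])] at hinv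
  have hinv' := Complex.ofReal_injective hinv
  have e1 : ∀ v : Ed d, Real.cos (2 * π * ⟪v, z⟫) * P a s ((2 * π) • v) =
      (fun y : Ed d => Real.cos ⟪y, z⟫ * P a s y) ((2 * π) • v) := by
    intro v; simp [real_inner_smul_left]
  simp_rw [e1] at hinv'
  have e2 := Measure.integral_comp_smul volume (fun y : Ed d => Real.cos ⟪y, z⟫ * P a s y) (2 * π)
  beta_reduce at e2
  rw [e2, finrank_euclideanSpace, Fintype.card_fin,
    abs_of_pos (by positivity), smul_eq_mul] at hinv'
  rw [← hinv', mul_inv_cancel_left₀ (by positivity)]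

lemma P_bound {d : ℕ} {a s : ℝ} (ha : 0 < a) (hs : 0 < s) :
    ∃ M, ∀ x : Ed d, |P a s x| ≤ M := by
  refine ⟨∫ z : Ed d, Real.exp (-s * Lam z ^ a), fun x => ?_⟩
  rw [← Real.norm_eq_abs]
  refine norm_integral_le_of_norm_le (integrable_f d ha hs) (Eventually.of_forall fun z => ?_)
  rw [norm_mul, Real.norm_eq_abs, Real.norm_eq_abs, Real.abs_exp]
  exact mul_le_of_le_one_left (Real.exp_pos _).le (Real.abs_cos_le_one _)

lemma CK {d : ℕ} (hd : 0 < d) {a s t : ℝ} (ha : a ∈ Ioo (0:ℝ) 1) (ht : 0 < t) (hs : 0 < s) (x : Ed d) :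
    Integrable (fun y : Ed d => P a t (y - x) * P a s y) ∧
    ∫ y : Ed d, P a t (y - x) * P a s y = (2 * π) ^ d * P a (t + s) x := by
  have hPi := P_integrable hd ha hs
  have hf := integrable_f d ha.1 ht
  constructor
  · obtain ⟨M, hM⟩ := P_bound (d := d) ha.1 ht
    refine hPi.bdd_mul (c := M) ?_ (Eventually.of_forall fun y => hM _)
    exact ((P_meas_x a t).comp (measurable_id.sub_const x)).aestronglyMeasurable
  · have hI : Integrable (fun p : Ed d × Ed d => (Real.cos ⟪p.1 - x, p.2⟫ * Real.exp (-t * Lam p.2 ^ a)) * P a s p.1)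
        (volume.prod volume) := by
      have h1 := Integrable.mul_prod hPi hf
      have h2 : Integrable (fun p : Ed d × Ed d => Real.cos ⟪p.1 - x, p.2⟫ * (P a s p.1 * Real.exp (-t * Lam p.2 ^ a)))
          (volume.prod volume) := by
        refine h1.bdd_mul (c := 1) (Continuous.aestronglyMeasurable (by fun_prop)) (Eventually.of_forall fun v => ?_)
        exact Real.abs_cos_le_one _
      refine h2.congr (Eventually.of_forall fun p => ?_)
      beta_reduce; ring
    have e0 : ∀ y : Ed d, P a t (y - x) * P a s y =
        ∫ z, (Real.cos ⟪y - x, z⟫ * Real.exp (-t * Lam z ^ a)) * P a s y := by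
      intro y; rw [integral_mul_const]; rfl
    simp_rw [e0]
    rw [integral_integral_swap (f := fun y z => (Real.cos ⟪y - x, z⟫ * Real.exp (-t * Lam z ^ a)) * P a s y) hI]
    have e1 : ∀ z : Ed d, ∫ y : Ed d, (Real.cos ⟪y - x, z⟫ * Real.exp (-t * Lam z ^ a)) * P a s y
        = (2 * π) ^ d * (Real.cos ⟪x, z⟫ * Real.exp (-(t + s) * Lam z ^ a)) := by
      intro z
      have h1 : ∀ y : Ed d, (Real.cos ⟪y - x, z⟫ * Real.exp (-t * Lam z ^ a)) * P a s y =
          (Real.exp (-t * Lam z ^ a) * Real.cos ⟪x, z⟫) * (Real.cos ⟪y, z⟫ * P a s y) +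
          (Real.exp (-t * Lam z ^ a) * Real.sin ⟪x, z⟫) * (Real.sin ⟪y, z⟫ * P a s y) := by
        intro y
        rw [inner_sub_left, Real.cos_sub]; ring
      simp_rw [h1]
      have i1 : Integrable (fun y : Ed d => Real.cos ⟪y, z⟫ * P a s y) := by
        refine hPi.bdd_mul (c := 1) (Continuous.aestronglyMeasurable (by fun_prop)) (Eventually.of_forall fun v => ?_)
        exact Real.abs_cos_le_one _
      have i2 : Integrable (fun y : Ed d => Real.sin ⟪y, z⟫ * P a s y) := by
        refine hPi.bdd_mul (c := 1) (Continuous.aestronglyMeasurable (by fun_prop)) (Eventually.of_forall fun v => ?_)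
        exact Real.abs_sin_le_one _
      rw [integral_add (i1.const_mul _) (i2.const_mul _), integral_const_mul, integral_const_mul,
        P_inv hd ha hs, integral_odd (fun y : Ed d => Real.sin ⟪y, z⟫ * P a s y)
        (by intro y; simp [inner_neg_left, P_neg]),
        show -(t + s) * Lam z ^ a = -t * Lam z ^ a + -s * Lam z ^ a by ring, Real.exp_add]
      ring
    simp_rw [e1]
    rw [integral_const_mul]; rfl

lemma shift_int (φ q : ℝ → ℝ) {s : ℝ} (hs : 0 ≤ s) :
    ∫ u in Ioi (0:ℝ), φ u * q (s + u) =
      ∫ r in Ioi (0:ℝ), (if s < r then φ (r - s) * q r else 0) := by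
  rw [← integral_indicator measurableSet_Ioi, ← integral_indicator measurableSet_Ioi]
  rw [← integral_add_left_eq_self (μ := volume)
    ((Ioi (0:ℝ)).indicator (fun r => if s < r then φ (r - s) * q r else 0)) s]
  congr 1; ext u
  by_cases hu : 0 < u
  · have h1 : 0 < s + u := by linarith
    simp [indicator, hu, h1]
  · simp [indicator, hu]

lemma inner_int {γ t r : ℝ} (hγ : 0 < γ) (ht : 0 < t) (hr : 0 < r) :
    IntegrableOn (fun s => if s < r then γ * (r - s) ^ (γ - 1) else 0) (Ioo 0 t) ∧
    ∫ s in Ioo 0 t, (if s < r then γ * (r - s) ^ (γ - 1) else 0) = r ^ γ - (r - min t r) ^ γ := by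
  have hm : 0 < min t r := lt_min ht hr
  have e : (fun s => if s < r then γ * (r - s) ^ (γ - 1) else 0)
      = (Iio r).indicator (fun s => γ * (r - s) ^ (γ - 1)) := by
    ext s; simp [indicator]
  have eI : Ioo 0 t ∩ Iio r = Ioo 0 (min t r) := by
    ext s; simp [and_assoc]
  have hIntg : IntervalIntegrable (fun s => γ * (r - s) ^ (γ - 1)) volume 0 (min t r) := by
    have h1 : IntervalIntegrable (fun u : ℝ => u ^ (γ - 1)) volume (r - 0) (r - min t r) :=
      intervalIntegral.intervalIntegrable_rpow' (by linarith)
    simpa using (h1.comp_sub_left r).const_mul γ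
  rw [e]
  constructor
  · rw [IntegrableOn, integrable_indicator_iff measurableSet_Iio, IntegrableOn,
      Measure.restrict_restrict measurableSet_Iio, inter_comm, eI]
    exact hIntg.1.mono_set Ioo_subset_Ioc_self
  · rw [setIntegral_indicator measurableSet_Iio, eI, ← integral_Ioc_eq_integral_Ioo,
      ← intervalIntegral.integral_of_le hm.le, intervalIntegral.integral_const_mul,
      intervalIntegral.integral_comp_sub_left (fun u : ℝ => u ^ (γ - 1)) r,
      integral_rpow (Or.inl (by linarith))]
    simp only [sub_zero, sub_add_cancel]
    field_simp

lemma time_identity {q : ℝ → ℝ} (hq : Measurable q) {K γ t : ℝ} (hγ : 0 < γ) (ht : 0 < t)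
    (h0 : ∀ r, 0 < r → 0 ≤ q r) (hK : ∀ r, 0 < r → q r ≤ K * Real.exp (-r)) :
    (∫ u in Ioi (0:ℝ), u ^ γ * q (t + u)) +
      (∫ s in Ioo 0 t, γ * ∫ u in Ioi (0:ℝ), u ^ (γ - 1) * q (s + u)) =
    ∫ r in Ioi (0:ℝ), r ^ γ * q r := by
  have hbase : IntegrableOn (fun r : ℝ => K * (Real.exp (-r) * r ^ γ)) (Ioi 0) := by
    have := (Real.GammaIntegral_convergent (s := γ + 1) (by linarith)).const_mul K
    simpa [IntegrableOn] using this
  have hmin : ∀ r : ℝ, 0 < r → 0 ≤ r - min t r ∧ r - min t r ≤ r := fun r hr =>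
    ⟨by linarith [min_le_right t r], by linarith [lt_min ht hr]⟩
  have hi1 : IntegrableOn (fun r : ℝ => r ^ γ * q r) (Ioi 0) := by
    refine hbase.mono' (Measurable.aestronglyMeasurable (by fun_prop)) ?_
    filter_upwards [ae_restrict_mem measurableSet_Ioi] with r hr
    have hr' : 0 < r := hr
    have h1 : 0 ≤ r ^ γ := by positivity
    rw [Real.norm_eq_abs, abs_of_nonneg (mul_nonneg h1 (h0 r hr))]
    calc _ ≤ r ^ γ * (K * Real.exp (-r)) := by gcongr; exact hK r hr
      _ = _ := by ring
  have hi2 : IntegrableOn (fun r : ℝ => (r - min t r) ^ γ * q r) (Ioi 0) := by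
    refine hbase.mono' (Measurable.aestronglyMeasurable (by fun_prop)) ?_
    filter_upwards [ae_restrict_mem measurableSet_Ioi] with r hr
    have hr' : 0 < r := hr
    obtain ⟨hm0, hm1⟩ := hmin r hr
    have h1 : 0 ≤ (r - min t r) ^ γ := by positivity
    have h2 := h0 r hr
    rw [Real.norm_eq_abs, abs_of_nonneg (mul_nonneg h1 h2)]
    calc _ ≤ r ^ γ * (K * Real.exp (-r)) := by gcongr; exact hK r hr
      _ = _ := by ring
  have A : ∫ u in Ioi (0:ℝ), u ^ γ * q (t + u) = ∫ r in Ioi (0:ℝ), (r - min t r) ^ γ * q r := by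
    rw [shift_int (fun u => u ^ γ) q ht.le]
    refine setIntegral_congr_fun measurableSet_Ioi fun r hr => ?_
    beta_reduce
    split_ifs with h
    · rw [min_eq_left h.le]
    · rw [min_eq_right (not_lt.1 h), sub_self, Real.zero_rpow hγ.ne', zero_mul]
  let H : ℝ → ℝ → ℝ := fun s r => (if s < r then γ * (r - s) ^ (γ - 1) else 0) * q r
  have B1 : ∫ s in Ioo 0 t, γ * ∫ u in Ioi (0:ℝ), u ^ (γ - 1) * q (s + u)
      = ∫ s in Ioo 0 t, ∫ r in Ioi (0:ℝ), H s r := by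
    refine setIntegral_congr_fun measurableSet_Ioo fun s hs => ?_
    beta_reduce
    rw [shift_int (fun u => u ^ (γ - 1)) q hs.1.le, ← integral_const_mul]
    congr 1; ext r; simp only [H]; split_ifs <;> ring
  have hHm : Measurable (Function.uncurry H) := by
    unfold Function.uncurry
    simp only [H]
    refine Measurable.mul ?_ (hq.comp measurable_snd)
    refine Measurable.ite (measurableSet_lt measurable_fst measurable_snd) (by fun_prop) measurable_const
  have hW : ∀ r, 0 < r → ∫ s in Ioo 0 t, H s r = (r ^ γ - (r - min t r) ^ γ) * q r := by
    intro r hr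
    simp only [H]
    rw [integral_mul_const, (inner_int hγ ht hr).2]
  have hHi : Integrable (Function.uncurry H) ((volume.restrict (Ioo 0 t)).prod (volume.restrict (Ioi 0))) := by
    rw [integrable_prod_iff' hHm.aestronglyMeasurable]
    constructor
    · filter_upwards [ae_restrict_mem measurableSet_Ioi] with r hr
      exact (inner_int hγ ht hr).1.mul_const (q r)
    · refine (hi1.sub hi2).congr ?_
      filter_upwards [ae_restrict_mem measurableSet_Ioi] with r hr
      have : ∫ s in Ioo 0 t, ‖Function.uncurry H (s, r)‖ = ∫ s in Ioo 0 t, H s r := by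
        congr 1; ext s
        have hh : 0 ≤ H s r := by
          simp only [H]
          refine mul_nonneg ?_ (h0 r hr)
          split_ifs with h
          · exact mul_nonneg hγ.le (Real.rpow_nonneg (by linarith) _)
          · exact le_rfl
        rw [Real.norm_eq_abs]; exact abs_of_nonneg hh
      rw [this, hW r hr]; simp only [Pi.sub_apply]; ring
  rw [A, B1, integral_integral_swap hHi,
    setIntegral_congr_fun measurableSet_Ioi (fun r hr => hW r hr)]
  rw [← integral_add]
  · congr 1; ext r; ring
  · exact hi2
  · refine (hi1.sub hi2).congr (Eventually.of_forall fun r => ?_)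
    simp only [Pi.sub_apply]; ring

lemma P_meas_s {d : ℕ} (a : ℝ) (x : Ed d) : Measurable (fun s : ℝ => P a s x) := by
  have h : Measurable (fun s : ℝ => ((s, x) : ℝ × Ed d)) := measurable_prodMk_right
  have h2 := Measurable.comp (P_meas d a) h
  exact h2

lemma relKernel_eq {d : ℕ} (α t : ℝ) (x y : Ed d) :
    relKernel d α 1 t x y = (2 * π) ^ (-(d:ℝ)) * P (α / 2) t (y - x) := by
  unfold relKernel P F Lam; simp

lemma potential {d : ℕ} (hd : 0 < d) {a : ℝ} (ha : a ∈ Ioo (0:ℝ) 1) {δ s : ℝ} (hδ : -1 < δ)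
    (hs : 0 < s) (x : Ed d) (hx : x ≠ 0) :
    ∫ y : Ed d, P a s (y - x) * ∫ u in Ioi (0:ℝ), u ^ δ * P a u y
      = ∫ u in Ioi (0:ℝ), u ^ δ * ((2 * π) ^ d * P a (s + u) x) := by
  obtain ⟨K, hK, hKb⟩ := P_le_exp hd ha x hx
  let H : Ed d → ℝ → ℝ := fun y u => P a s (y - x) * (u ^ δ * P a u y)
  have hHm : Measurable (Function.uncurry H) := by
    unfold Function.uncurry
    simp only [H]
    have h1 : Measurable (fun p : Ed d × ℝ => P a s (p.1 - x)) :=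
      Measurable.comp (P_meas_x a s) (measurable_fst.sub_const x)
    have h2 : Measurable (fun p : Ed d × ℝ => P a p.2 p.1) := by
      have h3 := Measurable.comp (P_meas d a) (measurable_swap (α := Ed d) (β := ℝ))
      exact h3
    exact h1.mul ((measurable_snd.pow_const δ).mul h2)
  have hck : ∀ u, 0 < u → Integrable (fun y => H y u) ∧
      ∫ y, H y u = u ^ δ * ((2 * π) ^ d * P a (s + u) x) := by
    intro u hu
    obtain ⟨h1, h2⟩ := CK hd ha hs hu x
    have e : ∀ y, H y u = u ^ δ * (P a s (y - x) * P a u y) := fun y => by simp only [H]; ring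
    simp_rw [e]
    exact ⟨h1.const_mul _, by rw [integral_const_mul, h2]⟩
  have hHi : Integrable (Function.uncurry H) ((volume : Measure (Ed d)).prod (volume.restrict (Ioi 0))) := by
    rw [integrable_prod_iff' hHm.aestronglyMeasurable]
    constructor
    · filter_upwards [ae_restrict_mem measurableSet_Ioi] with u hu
      exact (hck u hu).1
    · have hbase : IntegrableOn (fun r : ℝ => ((2 * π) ^ d * K) * (Real.exp (-r) * r ^ δ)) (Ioi 0) := by
        have := (Real.GammaIntegral_convergent (s := δ + 1) (by linarith)).const_mul ((2 * π) ^ d * K)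
        simpa [IntegrableOn] using this
      refine hbase.mono' ?_ ?_
      · exact (hHm.norm.stronglyMeasurable.integral_prod_left').aestronglyMeasurable
      · filter_upwards [ae_restrict_mem measurableSet_Ioi] with u hu
        have hu' : 0 < u := hu
        have : ∫ y, ‖Function.uncurry H (y, u)‖ = ∫ y, H y u := by
          congr 1; ext y
          have hh : 0 ≤ H y u := mul_nonneg (P_nonneg hd ha hs _)
            (mul_nonneg (by positivity) (P_nonneg hd ha hu _))
          rw [Real.norm_eq_abs]; exact abs_of_nonneg hh
        have hp := P_nonneg hd ha (s := s + u) (by linarith) x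
        rw [this, (hck u hu).2, Real.norm_eq_abs, abs_of_nonneg (by positivity)]
        have h3 := hKb (s + u) (by linarith)
        have h4 : Real.exp (-(s + u)) ≤ Real.exp (-u) := Real.exp_le_exp.2 (by linarith)
        calc _ ≤ u ^ δ * ((2 * π) ^ d * (K * Real.exp (-u))) := by
              gcongr; exact h3.trans (by gcongr)
          _ = _ := by ring
  simp_rw [← integral_const_mul]
  rw [integral_integral_swap (f := H) hHi]
  exact setIntegral_congr_fun measurableSet_Ioi (fun u hu => (hck u hu).2)

lemma hBeta_eq {d : ℕ} (α β : ℝ) (x : Ed d) :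
    hBeta d α β x = (2 * π) ^ (-(d:ℝ)) *
      ∫ u in Ioi (0:ℝ), u ^ (((d:ℝ) - α - β) / α) * P (α / 2) u x := by
  unfold hBeta hBetaM
  rw [← integral_const_mul]
  congr 1; ext u
  rw [relKernel_eq, zero_sub, P_neg]; ring

end S18

/-- The fundamental identity for `p` and `h_β`, `h̄_β = ((d-α-β)/α) h_{β+α}` (Lemma 4.6). -/
theorem stmt_18 (d : ℕ) (α : ℝ) (hα : α ∈ Ioo 0 (min 2 (d : ℝ)))
    (β : ℝ) (hβ : β ∈ Ioo 0 ((d : ℝ) - α)) (t : ℝ) (ht : 0 < t) (x : Ed d) (hx : x ≠ 0) :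
    (∫ y : Ed d, relKernel d α 1 t x y * hBeta d α β y) +
        (∫ s in Ioo (0 : ℝ) t, ∫ y : Ed d,
          relKernel d α 1 s x y * ((((d : ℝ) - α - β) / α) * hBeta d α (β + α) y)) =
      hBeta d α β x := by
  obtain ⟨hα0, hα2⟩ := hα
  have hα1 : α < 2 := lt_of_lt_of_le hα2 (min_le_left _ _)
  have hαd : α < d := lt_of_lt_of_le hα2 (min_le_right _ _)
  have hd : 0 < d := by
    have : (0:ℝ) < d := hα0.trans hαd
    exact_mod_cast this
  have ha : α / 2 ∈ Ioo (0:ℝ) 1 := ⟨by linarith, by linarith⟩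
  set a := α / 2 with ha_def
  set γ := ((d:ℝ) - α - β) / α with hγ_def
  have hγ : 0 < γ := div_pos (by linarith [hβ.2]) hα0
  have hγ1 : ((d:ℝ) - α - (β + α)) / α = γ - 1 := by rw [hγ_def]; field_simp; ring
  set c : ℝ := (2 * π) ^ (-(d:ℝ)) with hc
  have hcc : c * (2 * π) ^ d = 1 := by
    rw [hc, Real.rpow_neg (by positivity), Real.rpow_natCast]
    exact inv_mul_cancel₀ (by positivity)
  have pot : ∀ (δ s : ℝ), -1 < δ → 0 < s →
      ∫ y : Ed d, (c * S18.P a s (y - x)) * (c * ∫ u in Ioi (0:ℝ), u ^ δ * S18.P a u y)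
        = c * ∫ u in Ioi (0:ℝ), u ^ δ * S18.P a (s + u) x := by
    intro δ s hδ hs
    have h := S18.potential hd ha hδ hs x hx
    have e1 : ∀ y : Ed d, (c * S18.P a s (y - x)) * (c * ∫ u in Ioi (0:ℝ), u ^ δ * S18.P a u y)
        = (c * c) * (S18.P a s (y - x) * ∫ u in Ioi (0:ℝ), u ^ δ * S18.P a u y) := fun y => by ring
    simp_rw [e1]
    rw [integral_const_mul, h]
    have e2 : ∀ u : ℝ, u ^ δ * ((2 * π) ^ d * S18.P a (s + u) x)
        = (2 * π) ^ d * (u ^ δ * S18.P a (s + u) x) := fun u => by ring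
    simp_rw [e2]
    rw [integral_const_mul, mul_assoc, ← mul_assoc c ((2 * π) ^ d), hcc, one_mul]
  obtain ⟨K, hK, hKb⟩ := S18.P_le_exp hd ha x hx
  have hqm : Measurable (fun s => S18.P a s x) :=
    S18.P_meas_s a x
  have main := S18.time_identity (q := fun s => S18.P a s x) hqm (K := K) hγ ht
    (fun r hr => S18.P_nonneg hd ha hr x) hKb
  simp_rw [S18.relKernel_eq, S18.hBeta_eq, hγ1]
  rw [← hγ_def, ← ha_def, ← hc, pot γ t (by linarith) ht, ← main, mul_add]
  congr 1
  rw [← integral_const_mul]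
  refine setIntegral_congr_fun measurableSet_Ioo fun s hs => ?_
  beta_reduce
  have e3 : ∀ y : Ed d, c * S18.P a s (y - x) * (γ * (c * ∫ u in Ioi (0:ℝ), u ^ (γ - 1) * S18.P a u y))
     = γ * (c * S18.P a s (y - x) * (c * ∫ u in Ioi (0:ℝ), u ^ (γ - 1) * S18.P a u y)) := fun y => by ring
  simp_rw [e3]
  rw [integral_const_mul, pot (γ - 1) s (by linarith) hs.1]
  ring
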